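/- (Local ubiquity) Let m, n be positive integers and let A ∈ M_{m,n}(ℝ) be non-singular, with ε > 0 such that the ε-return sequence L(ε) = {ℓ_1 < ℓ_2 < ⋯} is infinite. Set u_i = (1/2)(ε^{−m}+1) 2^{ℓ_i}, c_2 = ε ((1/2)(ε^{−m}+1))^{1+n/m}, and ρ(r) = c_2 r^{−n/m}. Then there exists a constant c_1 ∈ (0,1), depending only on ε, m, n and A, such that with l_i = c_1 u_i the following holds: for every ball B ⊂ 𝕋^m there exists i_0(B) such that for all i ≥ i_0(B), | B ∩ ⋃_{q ∈ ℤ^n : l_i < ‖q‖ ≤ u_i} B(Aq, ρ(u_i)) | ≥ (1/2)|B|. -/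

import Mathlib

open MeasureTheory Filter

/-- Distance from `x ∈ ℝ^k` to the nearest integer vector, in the sup norm. -/
noncomputable def intDist {k : ℕ} (x : Fin k → ℝ) : ℝ :=
  ⨅ p : Fin k → ℤ, ‖x - (fun i => (p i : ℝ))‖

/-- The canonical projection `ℝ^m → 𝕋^m = (ℝ/ℤ)^m`. -/
noncomputable def torusProj {m : ℕ} (x : Fin m → ℝ) : Fin m → AddCircle (1 : ℝ) :=
  fun i => (x i : AddCircle (1 : ℝ))

/-- `ℓ` belongs to the `ε`-return sequence `L(ε)` of `A`. -/
def InReturnSeq (m n : ℕ) (A : Matrix (Fin m) (Fin n) ℝ) (ε : ℝ) (ℓ : ℕ) : Prop :=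
  1 ≤ ℓ ∧ ¬ ∃ q : Fin n → ℤ,
    intDist (A.mulVec (fun j => (q j : ℝ))) < ε * (2 : ℝ) ^ (-(n : ℝ) * ℓ / m) ∧
    0 < ‖(fun j => (q j : ℝ))‖ ∧ ‖(fun j => (q j : ℝ))‖ < 2 ^ ℓ

/-- `u_i = (1/2)(ε^{-m}+1) 2^{ℓ_i}`. -/
noncomputable def uSeq (m : ℕ) (ε : ℝ) (ℓ : ℕ → ℕ) (i : ℕ) : ℝ :=
  (1 / 2) * (ε ^ (-(m : ℤ)) + 1) * 2 ^ (ℓ i)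

/-- The ubiquitous function `ρ(r) = c₂ r^{-n/m}` with
`c₂ = ε ((1/2)(ε^{-m}+1))^{1+n/m}`. -/
noncomputable def rhoFun (m n : ℕ) (ε : ℝ) (r : ℝ) : ℝ :=
  ε * ((1 / 2) * (ε ^ (-(m : ℤ)) + 1)) ^ ((1 : ℝ) + (n : ℝ) / m) * r ^ (-(n : ℝ) / m)


/-- Expanding a real number in base `K` gives a `θ` such that the numbers `θ * K ^ i` are close, modulo
integers, to prescribed values. -/
lemma exists_mul_pow_near (K : ℕ) (hK : 0 < K) (d : ℕ) (y : ℕ → ℝ) :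
    ∃ θ : ℝ, ∀ i < d, ∃ z : ℤ, |θ * (K : ℝ) ^ i - y i - z| ≤ 1 / K := by
  have hK' : (0 : ℝ) < K := by exact_mod_cast hK
  induction d generalizing y with
  | zero => exact ⟨0, by simp⟩
  | succ d ih =>
    obtain ⟨θ, hθ⟩ := ih (fun i => y (i + 1))
    set t : ℤ := ⌊K * y 0 - θ⌋ with ht
    have h1 : (t : ℝ) ≤ K * y 0 - θ := Int.floor_le _
    have h2 : K * y 0 - θ < t + 1 := Int.lt_floor_add_one _
    refine ⟨(θ + t) / K, fun i hi => ?_⟩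
    cases i with
    | zero =>
      refine ⟨0, ?_⟩
      have : (θ + t) / K * (K : ℝ) ^ 0 - y 0 - (0 : ℤ) = (θ + t - K * y 0) / K := by
        field_simp
        simp
      rw [this, abs_div, abs_of_pos hK']
      gcongr
      rw [abs_le]
      constructor <;> linarith
    | succ i =>
      obtain ⟨z, hz⟩ := hθ i (by omega)
      refine ⟨z + t * K ^ i, ?_⟩
      have : (θ + t) / K * (K : ℝ) ^ (i + 1) - y (i + 1) - ((z + t * K ^ i : ℤ) : ℝ)
          = θ * (K : ℝ) ^ i - y (i + 1) - z := by
        push_cast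
        field_simp
        ring
      rw [this]
      exact hz

section Lattice

variable {ι E : Type*} [Fintype ι] [NormedAddCommGroup E] [NormedSpace ℝ E]

/-- Some lattice vector `w` has the property that the multiples of `w / p` are nearly dense modulo the
lattice as soon as `p` is large. -/
lemma exists_span_smul_near (b : Module.Basis ι ℝ E) {δ : ℝ} (hδ : 0 < δ) :
    ∃ w ∈ Submodule.span ℤ (Set.range b), ∃ P : ℕ, ∀ p : ℕ, P ≤ p → 0 < p → ∀ y : E,
      ∃ j : ℤ, ∃ g ∈ Submodule.span ℤ (Set.range b), ‖((j : ℝ) / p) • w - y - g‖ < δ := by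
  classical
  set S : ℝ := ∑ i, ‖b i‖ with hS
  have hS0 : 0 ≤ S := Finset.sum_nonneg fun i _ => norm_nonneg _
  obtain ⟨K, hK⟩ := exists_nat_gt (2 * S / δ)
  have hK' : (0 : ℝ) < K := lt_of_le_of_lt (by positivity) hK
  have hK0 : 0 < K := by exact_mod_cast hK'
  have hK1 : (1 : ℝ) ≤ K := by exact_mod_cast hK0
  set d := Fintype.card ι with hd
  let e := Fintype.equivFin ι
  have hmem : ∀ c : ι → ℤ, ∑ i, (c i : ℝ) • b i ∈ Submodule.span ℤ (Set.range b) := by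
    intro c
    refine Submodule.sum_mem _ fun i _ => ?_
    rw [Int.cast_smul_eq_zsmul]
    exact Submodule.smul_mem _ _ (Submodule.subset_span ⟨i, rfl⟩)
  refine ⟨∑ i, (((K ^ (e i : ℕ) : ℕ) : ℤ) : ℝ) • b i, hmem _, K ^ (d + 1), fun p hp hp0 y => ?_⟩
  have hp' : (0 : ℝ) < p := by exact_mod_cast hp0
  obtain ⟨θ, hθ⟩ := exists_mul_pow_near K hK0 d
    (fun i => if h : i < d then b.repr y (e.symm ⟨i, h⟩) else 0)
  set j : ℤ := round (p * θ) with hj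
  have hj1 : |(j : ℝ) / p - θ| ≤ 1 / p := by
    have h := abs_sub_round ((p : ℝ) * θ)
    rw [abs_sub_comm] at h
    have : (j : ℝ) / p - θ = (j - p * θ) / p := by field_simp
    rw [this, abs_div, abs_of_pos hp']
    gcongr
    exact h.trans (by norm_num)
  have key : ∀ i : ι, ∃ z : ℤ, |(j : ℝ) / p * (K : ℝ) ^ (e i : ℕ) - b.repr y i - z| ≤ 2 / K := by
    intro i
    obtain ⟨z, hz⟩ := hθ (e i) (e i).2
    refine ⟨z, ?_⟩
    have h0 : (if h : (e i : ℕ) < d then b.repr y (e.symm ⟨e i, h⟩) else 0) = b.repr y i := by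
      rw [dif_pos (e i).2]
      simp
    simp only [h0] at hz
    have h1 : |((j : ℝ) / p - θ) * (K : ℝ) ^ (e i : ℕ)| ≤ 1 / K := by
      rw [abs_mul, abs_of_pos (pow_pos hK' (e i : ℕ))]
      have h2 : (K : ℝ) ^ (e i : ℕ) ≤ (K : ℝ) ^ d := pow_le_pow_right₀ hK1 (e i).2.le
      have h3 : (K : ℝ) ^ (d + 1) ≤ p := by exact_mod_cast hp
      calc |(j : ℝ) / p - θ| * (K : ℝ) ^ (e i : ℕ) ≤ 1 / p * (K : ℝ) ^ d := by gcongr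
        _ ≤ 1 / (K : ℝ) ^ (d + 1) * (K : ℝ) ^ d := by gcongr
        _ = 1 / K := by
          rw [pow_succ]
          field_simp
    have h4 : (j : ℝ) / p * (K : ℝ) ^ (e i : ℕ) - b.repr y i - z
        = ((j : ℝ) / p - θ) * (K : ℝ) ^ (e i : ℕ)
          + (θ * (K : ℝ) ^ (e i : ℕ) - b.repr y i - z) := by ring
    rw [h4]
    calc _ ≤ _ := abs_add_le _ _
      _ ≤ 1 / (K : ℝ) + 1 / K := add_le_add h1 hz
      _ = 2 / K := by ring
  choose z hz using key
  refine ⟨j, ∑ i, (z i : ℝ) • b i, hmem z, ?_⟩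
  have hy : y = ∑ i, b.repr y i • b i := (b.sum_repr y).symm
  have hdiff : ((j : ℝ) / p) • (∑ i, (((K ^ (e i : ℕ) : ℕ) : ℤ) : ℝ) • b i) - y
      - ∑ i, (z i : ℝ) • b i
      = ∑ i, ((j : ℝ) / p * (K : ℝ) ^ (e i : ℕ) - b.repr y i - z i) • b i := by
    conv_lhs => rw [hy]
    rw [Finset.smul_sum, ← Finset.sum_sub_distrib, ← Finset.sum_sub_distrib]
    refine Finset.sum_congr rfl fun i _ => ?_
    rw [sub_smul, sub_smul, mul_smul]
    push_cast
    rfl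
  rw [hdiff]
  calc _ ≤ ∑ i, ‖((j : ℝ) / p * (K : ℝ) ^ (e i : ℕ) - b.repr y i - z i) • b i‖ :=
        norm_sum_le _ _
    _ ≤ ∑ i, 2 / K * ‖b i‖ := by
        refine Finset.sum_le_sum fun i _ => ?_
        rw [norm_smul, Real.norm_eq_abs]
        exact mul_le_mul_of_nonneg_right (hz i) (norm_nonneg _)
    _ = 2 * S / K := by rw [← Finset.mul_sum]; ring
    _ < δ := by
        rw [div_lt_iff₀ hδ] at hK
        rw [div_lt_iff₀ hK']
        linarith

open scoped Pointwise in
/-- If nonzero lattice vectors have norm at least one, then a ball of radius `1 / 2` has the same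
measure as its trace on a fundamental domain. -/
lemma measure_fundamentalDomain_near [MeasurableSpace E] [BorelSpace E]
    (b : Module.Basis ι ℝ E) (μ : Measure E) [μ.IsAddHaarMeasure]
    (hmin : ∀ v ∈ Submodule.span ℤ (Set.range b), v ≠ 0 → 1 ≤ ‖v‖) (c : E) :
    μ (ZSpan.fundamentalDomain b ∩
      {x | ∃ g ∈ Submodule.span ℤ (Set.range b), ‖c - x - g‖ < 1 / 2}) =
      μ (Metric.ball 0 (1 / 2)) := by
  have : FiniteDimensional ℝ E := Module.Finite.of_basis b
  set Λ := Submodule.span ℤ (Set.range b) with hΛ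
  have : Countable Λ := inferInstance
  have : VAddInvariantMeasure (Submodule.span ℤ (Set.range b)) E μ :=
    ⟨fun g s _ => measure_preimage_add μ (g : E) s⟩
  have : MeasurableConstVAdd (Submodule.span ℤ (Set.range b)) E :=
    ⟨fun g => measurable_const_add (g : E)⟩
  have hF := ZSpan.isAddFundamentalDomain b μ
  have hball : μ (Metric.ball (0 : E) (1 / 2)) = μ (Metric.ball c (1 / 2)) := by
    rw [Measure.addHaar_ball_center μ c]
  rw [hball, hF.measure_eq_tsum (Metric.ball c (1 / 2)), ← measure_iUnion]
  · congr 1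
    ext x
    simp only [Set.mem_inter_iff, Set.mem_ofPred_eq, Set.mem_iUnion, Set.mem_vadd_set_iff_neg_vadd_mem,
      Metric.mem_ball, dist_eq_norm, Subtype.exists]
    constructor
    · rintro ⟨hx, g, hg, h⟩
      refine ⟨-g, Λ.neg_mem hg, ?_, hx⟩
      change ‖-(-g) + x - c‖ < 1 / 2
      rwa [show -(-g) + x - c = -(c - x - g) by abel, norm_neg]
    · rintro ⟨g, hg, h, hx⟩
      refine ⟨hx, -g, Λ.neg_mem hg, ?_⟩
      change ‖-g + x - c‖ < 1 / 2 at h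
      rwa [show c - x - -g = -(-g + x - c) by abel, norm_neg]
  · intro g g' hgg'
    refine Set.disjoint_left.2 fun x hx hx' => ?_
    have h1 := hx.1
    have h2 := hx'.1
    rw [Set.mem_vadd_set_iff_neg_vadd_mem, Metric.mem_ball, dist_eq_norm] at h1 h2
    have hne : ((g - g' : Λ) : E) ≠ 0 := by
      simpa [sub_eq_zero] using hgg'
    have h3 := hmin _ (g - g').2 hne
    have h4 : ((g - g' : Λ) : E) = ((-g' +ᵥ x) - c) - ((-g +ᵥ x) - c) := by
      simp [Submodule.vadd_def]
      abel
    rw [h4] at h3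
    linarith [norm_sub_le ((-g' +ᵥ x) - c) ((-g +ᵥ x) - c)]
  · intro g
    refine MeasurableSet.inter ?_ (ZSpan.fundamentalDomain_measurableSet b)
    exact (Metric.isOpen_ball.measurableSet).const_vadd g

end Lattice

open scoped Pointwise in
/-- Iterated Cauchy–Davenport inequality. -/
lemma ZMod.min_le_card_of_add_subset {p : ℕ} (hp : p.Prime) (T : ℕ → Finset (ZMod p))
    (hT : ∀ k, T k + T 1 ⊆ T (k + 1)) (h1 : (T 1).Nonempty) (k : ℕ) :
    min p ((k + 1) * ((T 1).card - 1) + 1) ≤ (T (k + 1)).card := by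
  have hpos := h1.card_pos
  induction k with
  | zero => simp; right; omega
  | succ k ih =>
    have hne : (T (k + 1)).Nonempty := by
      rw [← Finset.card_pos]
      have := hp.pos
      omega
    have h := (ZMod.cauchy_davenport hp hne h1).trans (Finset.card_le_card (hT (k + 1)))
    have e : (k + 1 + 1) * ((T 1).card - 1) = (k + 1) * ((T 1).card - 1) + ((T 1).card - 1) := by ring
    rw [e]
    omega

open scoped Pointwise in
/-- If nonzero lattice vectors have norm at least one and the covolume is less than `k` times the volume
of a ball of radius `1 / 2`, then every point is within distance `k / 2` of the lattice. -/
lemma exists_span_norm_sub_le {ι E : Type*} [Fintype ι] [NormedAddCommGroup E] [NormedSpace ℝ E]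
    [MeasurableSpace E] [BorelSpace E] (b : Module.Basis ι ℝ E) (μ : Measure E)
    [μ.IsAddHaarMeasure]
    (hmin : ∀ v ∈ Submodule.span ℤ (Set.range b), v ≠ 0 → 1 ≤ ‖v‖) (k : ℕ)
    (hk : μ (ZSpan.fundamentalDomain b) < k * μ (Metric.ball 0 (1 / 2))) (y : E) :
    ∃ g ∈ Submodule.span ℤ (Set.range b), ‖y - g‖ ≤ k / 2 := by
  classical
  have : FiniteDimensional ℝ E := Module.Finite.of_basis b
  have : ProperSpace E := FiniteDimensional.proper ℝ E
  set Λ := Submodule.span ℤ (Set.range b) with hΛ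
  suffices H : ∀ δ > 0, ∃ g ∈ Λ, ‖y - g‖ < k / 2 + δ by
    have hcl : IsClosed (Λ : Set E) := @AddSubgroup.isClosed_of_discrete _ _ _ _ _
      Λ.toAddSubgroup (inferInstanceAs (DiscreteTopology (Submodule.span ℤ (Set.range b))))
    obtain ⟨g, hg, hgd⟩ := hcl.exists_infDist_eq_dist ⟨0, Λ.zero_mem⟩ y
    refine ⟨g, hg, le_of_forall_pos_le_add fun δ hδ => ?_⟩
    obtain ⟨g', hg', h⟩ := H δ hδ
    rw [← dist_eq_norm] at h ⊢
    rw [← hgd]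
    exact (Metric.infDist_le_dist_of_mem hg').trans h.le
  intro δ hδ
  have hk0 : k ≠ 0 := by
    rintro rfl
    simp at hk
  set F := ZSpan.fundamentalDomain b with hF
  have hFtop : μ F ≠ ⊤ := (ZSpan.fundamentalDomain_isBounded b).measure_lt_top.ne
  have hVtop : μ (Metric.ball (0 : E) (1 / 2)) ≠ ⊤ := measure_ball_lt_top.ne
  set V := (μ (Metric.ball (0 : E) (1 / 2))).toReal with hV
  set W := (μ F).toReal with hW
  have hWV : W < k * V := by
    have := (ENNReal.toReal_lt_toReal hFtop (ENNReal.mul_ne_top (by simp) hVtop)).2 hk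
    simpa [hV, hW] using this
  obtain ⟨w, hw, P, hP⟩ := exists_span_smul_near b hδ
  obtain ⟨N, hN⟩ := exists_nat_gt (k * W / (k * V - W))
  obtain ⟨p, hpge, hp⟩ := Nat.exists_infinite_primes (max P N)
  have hp0 : (0 : ℝ) < p := by exact_mod_cast hp.pos
  have : NeZero p := ⟨hp.ne_zero⟩
  set φ : ZMod p → E := fun j => ((j.val : ℝ) / p) • w with hφ
  have hφint : ∀ j : ℤ, ∃ g ∈ Λ, φ (j : ZMod p) = ((j : ℝ) / p) • w + g := by
    intro j
    refine ⟨(-(j / p)) • w, Λ.smul_mem _ hw, ?_⟩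
    have h1 : (((j : ZMod p).val : ℤ) : ℝ) = j - p * ((j / p : ℤ) : ℝ) := by
      rw [ZMod.val_intCast, Int.emod_def]
      push_cast
      ring
    rw [Int.cast_natCast] at h1
    simp only [hφ]
    rw [h1, ← Int.cast_smul_eq_zsmul ℝ, ← add_smul]
    congr 1
    push_cast
    field_simp
    ring
  have hφadd : ∀ i j : ZMod p, ∃ g ∈ Λ, φ (i + j) = φ i + φ j + g := by
    intro i j
    obtain ⟨g, hg, h⟩ := hφint ((i.val + j.val : ℕ) : ℤ)
    refine ⟨g, hg, ?_⟩
    have h2 : (((i.val + j.val : ℕ) : ℤ) : ZMod p) = i + j := by simp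
    rw [h2] at h
    rw [h]
    simp only [hφ]
    rw [← add_smul]
    congr 2
    push_cast
    ring
  let T : E → ℕ → Finset (ZMod p) := fun x a =>
    Finset.univ.filter fun j => ∃ g ∈ Λ, ‖φ j - (a : ℝ) • x - g‖ < a / 2
  have hTadd : ∀ x a, T x a + T x 1 ⊆ T x (a + 1) := by
    intro x a j hj
    obtain ⟨i, hi, i', hi', rfl⟩ := Finset.mem_add.1 hj
    simp only [T, Finset.mem_filter, Finset.mem_univ, true_and] at hi hi' ⊢
    obtain ⟨g, hg, h⟩ := hi
    obtain ⟨g', hg', h'⟩ := hi'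
    obtain ⟨g'', hg'', h''⟩ := hφadd i i'
    refine ⟨g + g' + g'', Λ.add_mem (Λ.add_mem hg hg') hg'', ?_⟩
    have e : φ (i + i') - ((a + 1 : ℕ) : ℝ) • x - (g + g' + g'')
        = (φ i - (a : ℝ) • x - g) + (φ i' - ((1 : ℕ) : ℝ) • x - g') := by
      rw [h'']
      push_cast
      rw [add_smul]
      abel
    rw [e]
    refine (norm_add_le _ _).trans_lt ((add_lt_add h h').trans_eq ?_)
    push_cast
    ring
  have hx : ∃ x, p + k ≤ k * (T x 1).card := by
    by_contra! hcon
    let D : ZMod p → Set E := fun j => {x | ∃ g ∈ Λ, ‖φ j - x - g‖ < 1 / 2}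
    have hDopen : ∀ j, IsOpen (D j) := by
      intro j
      have : D j = ⋃ g ∈ Λ, {x | ‖φ j - x - g‖ < 1 / 2} := by
        ext x
        simp [D]
      rw [this]
      exact isOpen_biUnion fun g _ => isOpen_lt (by fun_prop) continuous_const
    have h1 : ∀ j, ∫⁻ x in F, (D j).indicator 1 x ∂μ = μ (Metric.ball (0 : E) (1 / 2)) := by
      intro j
      rw [lintegral_indicator_one (hDopen j).measurableSet,
        Measure.restrict_apply (hDopen j).measurableSet, Set.inter_comm]
      exact measure_fundamentalDomain_near b μ hmin (φ j)
    have h2 : (k : ENNReal) * (p * μ (Metric.ball (0 : E) (1 / 2))) ≤ (p + k) * μ F := by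
      calc (k : ENNReal) * (p * μ (Metric.ball (0 : E) (1 / 2)))
          = k * ∑ j : ZMod p, ∫⁻ x in F, (D j).indicator 1 x ∂μ := by
            simp [h1, ZMod.card]
        _ = k * ∫⁻ x in F, ∑ j : ZMod p, (D j).indicator 1 x ∂μ := by
            rw [lintegral_finsetSum]
            intro j _
            exact measurable_one.indicator (hDopen j).measurableSet
        _ = ∫⁻ x in F, k * ∑ j : ZMod p, (D j).indicator 1 x ∂μ := by
            rw [lintegral_const_mul]
            exact Finset.measurable_sum _ fun j _ =>
              measurable_one.indicator (hDopen j).measurableSet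
        _ ≤ ∫⁻ x in F, (p + k) ∂μ := by
            refine lintegral_mono fun x => ?_
            have h3 : ∑ j : ZMod p, (D j).indicator (1 : E → ENNReal) x = ((T x 1).card : ENNReal) := by
              simp [T, D, Set.indicator_apply]
            rw [h3]
            have h4 := (Nat.cast_le (α := ENNReal)).2 (hcon x).le
            push_cast at h4
            exact h4
        _ = (p + k) * μ F := by simp
    have h3 : (k : ℝ) * (p * V) ≤ (p + k) * W := by
      have := ENNReal.toReal_mono (ENNReal.mul_ne_top (by simp) hFtop) h2
      simpa [ENNReal.toReal_add, hV, hW] using this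
    have h4 : (N : ℝ) ≤ p := by exact_mod_cast (le_max_right _ _).trans hpge
    have h5 : k * W / (k * V - W) < p := hN.trans_le h4
    rw [div_lt_iff₀ (by linarith)] at h5
    nlinarith
  obtain ⟨x, hx⟩ := hx
  have hne : (T x 1).Nonempty := by
    rw [Finset.nonempty_iff_ne_empty]
    intro h
    rw [h] at hx
    have := hp.pos
    simp at hx
    omega
  have hfull : T x k = Finset.univ := by
    obtain ⟨a, rfl⟩ := Nat.exists_eq_succ_of_ne_zero hk0
    have h := ZMod.min_le_card_of_add_subset hp (T x) (hTadd x) hne a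
    rw [← Finset.card_eq_iff_eq_univ, ZMod.card]
    refine le_antisymm ((Finset.card_le_univ _).trans_eq (ZMod.card p)) ?_
    obtain ⟨c, hc⟩ := Nat.exists_eq_succ_of_ne_zero hne.card_pos.ne'
    rw [hc] at h hx
    simp only [Nat.succ_eq_add_one, Nat.add_sub_cancel, mul_add, mul_one] at h hx ⊢
    omega
  obtain ⟨j, g, hg, hj⟩ := hP p ((le_max_left _ _).trans hpge) hp.pos (y + (k : ℝ) • x)
  obtain ⟨g₁, hg₁, h₁⟩ := hφint j
  have h₂ : (j : ZMod p) ∈ T x k := by rw [hfull]; exact Finset.mem_univ _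
  simp only [T, Finset.mem_filter, Finset.mem_univ, true_and] at h₂
  obtain ⟨g₂, hg₂, h₂⟩ := h₂
  refine ⟨g₂ - g₁ - g, Λ.sub_mem (Λ.sub_mem hg₂ hg₁) hg, ?_⟩
  have e : y - (g₂ - g₁ - g) = (φ (j : ZMod p) - (k : ℝ) • x - g₂)
      - (((j : ℝ) / p) • w - (y + (k : ℝ) • x) - g) := by
    rw [h₁]
    abel
  rw [e]
  exact (norm_sub_le _ _).trans_lt (add_lt_add h₂ hj)

lemma intDist_le_norm_sub {k : ℕ} (x : Fin k → ℝ) (p : Fin k → ℤ) :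
    intDist x ≤ ‖x - (fun i => (p i : ℝ))‖ :=
  ciInf_le ⟨0, by rintro _ ⟨p, rfl⟩; exact norm_nonneg _⟩ p

/-- **Transference principle.** If the homogeneous system has no small integer solution, then every
inhomogeneous system has a solution. -/
lemma exists_inhomogeneous_solution {m n : ℕ} (A : Matrix (Fin m) (Fin n) ℝ) {C X : ℝ}
    (hC : 0 < C) (hC1 : C ≤ 1) (hX : 0 < X)
    (hA : ∀ q : Fin n → ℤ, q ≠ 0 → ‖(fun j => (q j : ℝ))‖ < X →
      C ≤ intDist (A.mulVec (fun j => (q j : ℝ))))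
    (k : ℕ) (hk : 1 < k * (C ^ m * X ^ n)) (α : Fin m → ℝ) :
    ∃ q : Fin n → ℤ, ‖(fun j => (q j : ℝ))‖ ≤ k / 2 * X ∧ ∃ P : Fin m → ℤ,
      ‖α - A.mulVec (fun j => (q j : ℝ)) - (fun i => (P i : ℝ))‖ ≤ k / 2 * C := by
  classical
  set B : Matrix (Fin m ⊕ Fin n) (Fin m ⊕ Fin n) ℝ :=
    Matrix.fromBlocks (C⁻¹ • 1) 0 (-C⁻¹ • A.transpose) (X⁻¹ • 1) with hB
  have hdet : B.det = C⁻¹ ^ m * X⁻¹ ^ n := by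
    rw [hB, Matrix.det_fromBlocks_zero₁₂]
    simp
  have hdet0 : 0 < B.det := by rw [hdet]; positivity
  have hli : LinearIndependent ℝ B.row :=
    Matrix.linearIndependent_rows_iff_isUnit.2
      ((Matrix.isUnit_iff_isUnit_det B).2 hdet0.ne'.isUnit)
  let b : Module.Basis (Fin m ⊕ Fin n) ℝ (Fin m ⊕ Fin n → ℝ) :=
    Module.Basis.mk hli (hli.span_eq_top_of_card_eq_finrank' (by simp)).ge
  have hb : ∀ i, b i = B i := fun i => Module.Basis.mk_apply hli _ i
  have hbB : Matrix.of b = B := by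
    ext i j
    simp [hb]
  have hc : ∀ (c : ℤ) i j, (c • B i) j = (c : ℝ) * B i j := fun c i j => zsmul_eq_mul (B i j) c
  have hsum : ∀ v ∈ Submodule.span ℤ (Set.range b), ∃ (P : Fin m → ℤ) (q : Fin n → ℤ),
      (∀ i, v (Sum.inl i) = C⁻¹ * (P i - A.mulVec (fun j => (q j : ℝ)) i)) ∧
      ∀ j, v (Sum.inr j) = X⁻¹ * q j := by
    intro v hv
    obtain ⟨c, rfl⟩ := (Submodule.mem_span_range_iff_exists_fun ℤ).1 hv
    refine ⟨fun i => c (Sum.inl i), fun j => c (Sum.inr j), fun i => ?_, fun j => ?_⟩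
    · simp only [Finset.sum_apply, Fintype.sum_sum_type, hb, hc]
      simp only [hB,
        Matrix.fromBlocks_apply₁₁, Matrix.fromBlocks_apply₂₁, Matrix.smul_apply, Matrix.one_apply,
        Matrix.transpose_apply, smul_eq_mul, mul_ite, mul_one, mul_zero,
        Finset.sum_ite_eq', Finset.mem_univ, if_true, Matrix.mulVec, dotProduct]
      rw [mul_sub, Finset.mul_sum, sub_eq_add_neg, ← Finset.sum_neg_distrib]
      congr 1
      · ring
      · exact Finset.sum_congr rfl fun j _ => by ring
    · simp only [Finset.sum_apply, Fintype.sum_sum_type, hb, hc]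
      simp only [hB,
        Matrix.fromBlocks_apply₁₂, Matrix.fromBlocks_apply₂₂, Matrix.smul_apply, Matrix.one_apply,
        Matrix.zero_apply, smul_eq_mul, mul_ite, mul_one, mul_zero,
        Finset.sum_ite_eq', Finset.mem_univ, if_true, Finset.sum_const_zero,
        zero_add]
      ring
  have hmin : ∀ v ∈ Submodule.span ℤ (Set.range b), v ≠ 0 → 1 ≤ ‖v‖ := by
    intro v hv hv0
    obtain ⟨P, q, h1, h2⟩ := hsum v hv
    by_contra! hlt
    have hq : ‖(fun j => (q j : ℝ))‖ < X := by
      rw [pi_norm_lt_iff hX]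
      intro j
      have h := (norm_le_pi_norm v (Sum.inr j)).trans_lt hlt
      rw [h2, norm_mul, norm_inv, Real.norm_of_nonneg hX.le, inv_mul_lt_iff₀ hX] at h
      simpa using h
    have hP : ∀ i, ‖(P i : ℝ) - A.mulVec (fun j => (q j : ℝ)) i‖ < C := by
      intro i
      have h := (norm_le_pi_norm v (Sum.inl i)).trans_lt hlt
      rw [h1, norm_mul, norm_inv, Real.norm_of_nonneg hC.le, inv_mul_lt_iff₀ hC] at h
      simpa using h
    by_cases hq0 : q = 0
    · subst hq0
      have hP0 : ∀ i, P i = 0 := by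
        intro i
        have h := (hP i).trans_le hC1
        have h3 : A.mulVec (fun j => (((0 : Fin n → ℤ) j : ℤ) : ℝ)) i = 0 := by
          simp [Matrix.mulVec, dotProduct]
        rw [h3, sub_zero, Real.norm_eq_abs] at h
        exact Int.abs_lt_one_iff.1 (by exact_mod_cast h)
      apply hv0
      ext i
      cases i with
      | inl i =>
        rw [h1, hP0]
        simp [Matrix.mulVec, dotProduct]
      | inr j =>
        rw [h2]
        simp
    · have h := (hA q hq0 hq).trans (intDist_le_norm_sub _ P)
      refine absurd h (not_le.2 ?_)
      rw [pi_norm_lt_iff hC]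
      intro i
      rw [Pi.sub_apply, norm_sub_rev]
      exact hP i
  have hk0 : (0 : ℝ) < k := by
    by_contra! hk0
    have : 0 < C ^ m * X ^ n := by positivity
    nlinarith
  have hvol : volume (ZSpan.fundamentalDomain b) <
      k * volume (Metric.ball (0 : Fin m ⊕ Fin n → ℝ) (1 / 2)) := by
    rw [ZSpan.volume_fundamentalDomain, hbB, Real.volume_pi_ball _ (by norm_num)]
    have : (k : ENNReal) = ENNReal.ofReal k := by simp
    rw [abs_of_pos hdet0, this, ← ENNReal.ofReal_mul hk0.le]
    rw [ENNReal.ofReal_lt_ofReal_iff (by positivity), hdet, inv_pow, inv_pow, ← mul_inv,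
      inv_lt_iff_one_lt_mul₀ (by positivity)]
    simpa [mul_comm] using hk
  obtain ⟨g, hg, hgk⟩ := exists_span_norm_sub_le b volume hmin k hvol
    (Sum.elim (fun i => C⁻¹ * α i) 0)
  obtain ⟨P, q, h1, h2⟩ := hsum g hg
  refine ⟨-q, ?_, P, ?_⟩
  · rw [pi_norm_le_iff_of_nonneg (by positivity)]
    intro j
    have h := (norm_le_pi_norm _ (Sum.inr j)).trans hgk
    simp only [Pi.sub_apply, Sum.elim_inr, Pi.zero_apply, h2, zero_sub, norm_neg, norm_mul, norm_inv,
      Real.norm_of_nonneg hX.le] at h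
    rw [inv_mul_le_iff₀ hX] at h
    simpa [mul_comm] using h
  · rw [pi_norm_le_iff_of_nonneg (by positivity)]
    intro i
    have h := (norm_le_pi_norm _ (Sum.inl i)).trans hgk
    simp only [Pi.sub_apply, Sum.elim_inl, h1, ← mul_sub, norm_mul, norm_inv,
      Real.norm_of_nonneg hC.le] at h
    rw [inv_mul_le_iff₀ hC, mul_comm C] at h
    refine le_trans (le_of_eq ?_) h
    congr 1
    have : (fun j => (((-q) j : ℤ) : ℝ)) = -(fun j => (q j : ℝ)) := by
      ext j
      simp
    rw [this, Matrix.mulVec_neg]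
    simp only [Pi.sub_apply, Pi.neg_apply]
    ring

lemma torusProj_add {m : ℕ} (a b : Fin m → ℝ) : torusProj (a + b) = torusProj a + torusProj b := by
  ext i
  simp [torusProj]

lemma dist_torusProj_le {m : ℕ} (a b : Fin m → ℝ) (P : Fin m → ℤ) :
    dist (torusProj a) (torusProj b) ≤ ‖a - b - (fun i => (P i : ℝ))‖ := by
  rw [dist_pi_le_iff (norm_nonneg _)]
  intro i
  refine le_trans ?_ (norm_le_pi_norm _ i)
  rw [torusProj, torusProj, dist_eq_norm, ← AddCircle.coe_sub, UnitAddCircle.norm_eq]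
  exact round_le _ _

lemma intDist_sub_le_dist {m : ℕ} (a b : Fin m → ℝ) :
    intDist (a - b) ≤ dist (torusProj a) (torusProj b) := by
  refine (intDist_le_norm_sub _ (fun i => round (a i - b i))).trans ?_
  rw [pi_norm_le_iff_of_nonneg dist_nonneg]
  intro i
  refine le_trans ?_ (dist_le_pi_dist _ _ i)
  rw [torusProj, torusProj, dist_eq_norm, ← AddCircle.coe_sub, UnitAddCircle.norm_eq]
  rfl

lemma torusProj_surjective {m : ℕ} : Function.Surjective (torusProj (m := m)) := by
  intro z
  choose α hα using fun i => QuotientAddGroup.mk_surjective (z i)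
  exact ⟨α, funext hα⟩

lemma volume_torus_ball {m : ℕ} (x : Fin m → AddCircle (1 : ℝ)) {r : ℝ} (hr : 0 < r) :
    volume (Metric.ball x r) = ENNReal.ofReal (min 1 (2 * r)) ^ m := by
  rw [volume_pi_ball _ hr]
  have : ∀ i, volume (Metric.ball (x i) r) = ENNReal.ofReal (min 1 (2 * r)) := fun i => by
    rw [← AddCircle.volume_closedBall (T := 1) (x := x i) r]
    exact (measure_congr AddCircle.closedBall_ae_eq_ball).symm
  simp [this]

lemma volume_torus_closedBall_diff_ball {m : ℕ} (x : Fin m → AddCircle (1 : ℝ)) {r : ℝ}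
    (hr : 0 < r) : volume (Metric.closedBall x r \ Metric.ball x r) = 0 := by
  have h : volume (Metric.closedBall x r) = volume (Metric.ball x r) := by
    rw [volume_torus_ball x hr, volume_pi_closedBall _ hr.le]
    simp [AddCircle.volume_closedBall]
  rw [measure_sdiff Metric.ball_subset_closedBall Metric.isOpen_ball.nullMeasurableSet
    (measure_ne_top _ _), h, tsub_self]

lemma volume_torus_ball_two_mul_le {m : ℕ} (x : Fin m → AddCircle (1 : ℝ)) {r : ℝ} (hr : 0 < r) :
    volume (Metric.ball x (2 * r)) ≤ 2 ^ m * volume (Metric.ball x r) := by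
  rw [volume_torus_ball x hr, volume_torus_ball x (by positivity), ← mul_pow]
  gcongr
  rw [show (2 : ENNReal) = ENNReal.ofReal 2 by simp, ← ENNReal.ofReal_mul (by norm_num)]
  refine ENNReal.ofReal_le_ofReal ?_
  rcases le_total 1 (2 * r) with h | h
  · rw [min_eq_left h]
    exact (min_le_left _ _).trans (by norm_num)
  · rw [min_eq_right h]
    exact (min_le_right _ _)

/-- The orbit map `q ↦ A q mod ℤ^m` on integer vectors. -/
noncomputable def torusOrbit {m n : ℕ} (A : Matrix (Fin m) (Fin n) ℝ) (q : Fin n → ℤ) :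
    Fin m → AddCircle (1 : ℝ) :=
  torusProj (A.mulVec (fun j => (q j : ℝ)))

lemma torusOrbit_add {m n : ℕ} (A : Matrix (Fin m) (Fin n) ℝ) (q v : Fin n → ℤ) :
    torusOrbit A (q + v) = torusOrbit A q + torusOrbit A v := by
  rw [torusOrbit, torusOrbit, torusOrbit, ← torusProj_add, ← Matrix.mulVec_add]
  congr 2
  ext j
  simp

lemma norm_cast_int_pi {n : ℕ} (q : Fin n → ℤ) : ‖(fun j => (q j : ℝ))‖ = ‖q‖ := by
  simp only [Pi.norm_def]
  congr

/-- Integer vectors nearly fixing the orbit are relatively dense. -/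
lemma exists_syndetic_return {m n : ℕ} (A : Matrix (Fin m) (Fin n) ℝ) {η : ℝ} (hη : 0 < η) :
    ∃ T : ℝ, 0 ≤ T ∧ ∀ q : Fin n → ℤ, ∃ v : Fin n → ℤ, ‖v - q‖ ≤ T ∧ ‖torusOrbit A v‖ < η := by
  have htb : TotallyBounded (Set.range (torusOrbit A)) :=
    (isCompact_univ.totallyBounded).subset (Set.subset_univ _)
  obtain ⟨t, ht, htf, hcov⟩ := totallyBounded_iff_subset.1 htb _ (Metric.dist_mem_uniformity hη)
  obtain ⟨s, hs⟩ : ∃ s : Finset (Fin n → ℤ), t ⊆ torusOrbit A '' s := by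
    obtain ⟨s, hs⟩ := (Set.subset_range_iff_exists_image_eq.1 ht)
    choose f hf using fun z : t => ht z.2
    have := htf.to_subtype
    refine ⟨(Set.finite_range f).toFinset, fun z hz => ⟨f ⟨z, hz⟩, ?_, hf ⟨z, hz⟩⟩⟩
    simp
  refine ⟨∑ f ∈ s, ‖f‖, Finset.sum_nonneg fun _ _ => norm_nonneg _, fun q => ?_⟩
  have hq := hcov ⟨q, rfl⟩
  simp only [Set.mem_iUnion] at hq
  obtain ⟨z, hz, hqz⟩ := hq
  obtain ⟨f, hf, rfl⟩ := hs hz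
  refine ⟨q - f, ?_, ?_⟩
  · rw [sub_sub_cancel_left, norm_neg]
    exact Finset.single_le_sum (f := fun f => ‖f‖) (fun _ _ => norm_nonneg _) hf
  · have h : torusOrbit A (q - f) = torusOrbit A q - torusOrbit A f := by
      rw [eq_sub_iff_add_eq, ← torusOrbit_add, sub_add_cancel]
    rw [h, ← dist_eq_norm]
    exact hqz

lemma volume_le_volume_inter_biUnion_ball {m n : ℕ} (A : Matrix (Fin m) (Fin n) ℝ) {U ρ : ℝ}
    (hρ : 0 < ρ) (hcov : ∀ z, ∃ q : Fin n → ℤ, ‖q‖ ≤ U ∧ dist z (torusOrbit A q) ≤ ρ)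
    (S : Set (Fin m → AddCircle (1 : ℝ))) :
    volume S ≤ volume (S ∩ ⋃ q ∈ {q : Fin n → ℤ | ‖q‖ ≤ U}, Metric.ball (torusOrbit A q) ρ) := by
  have hnull : volume (⋃ q : Fin n → ℤ,
      Metric.closedBall (torusOrbit A q) ρ \ Metric.ball (torusOrbit A q) ρ) = 0 :=
    measure_iUnion_null fun q => volume_torus_closedBall_diff_ball _ hρ
  rw [← add_zero (volume (S ∩ _)), ← hnull]
  refine (measure_mono fun z hz => ?_).trans (measure_union_le _ _)
  obtain ⟨q, hq, hzq⟩ := hcov z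
  rcases hzq.lt_or_eq with h | h
  · exact Or.inl ⟨hz, Set.mem_biUnion (show q ∈ {q : Fin n → ℤ | ‖q‖ ≤ U} from hq) h⟩
  · exact Or.inr (Set.mem_iUnion.2 ⟨q, h.le, fun h2 => (Metric.mem_ball.1 h2).ne h⟩)

/-- If the orbit is `C`-separated up to time `X` and has `K` well spaced near-returns, then short
orbit segments meet a ball in a set of small measure. -/
lemma measureReal_ball_inter_biUnion_ball_le {m n : ℕ} (A : Matrix (Fin m) (Fin n) ℝ)
    {C X ρ η r L : ℝ} (hC : 0 < C) (hC1 : C ≤ 1) (hρ : 0 < ρ) (hr : 0 < r)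
    (hsep : ∀ q : Fin n → ℤ, q ≠ 0 → ‖q‖ < X → C ≤ intDist (A.mulVec (fun j => (q j : ℝ))))
    {K : ℕ} (v : Fin K → Fin n → ℤ) (hvX : ∀ k, ‖v k‖ + L < X / 2)
    (hv : ∀ k k', k ≠ k' → 2 * L < ‖v k - v k'‖) (hvη : ∀ k, ‖torusOrbit A (v k)‖ < η)
    (hsum : ρ + η + C / 2 ≤ r) (x : Fin m → AddCircle (1 : ℝ)) :
    K * C ^ m * volume.real (Metric.ball x r ∩
        ⋃ q ∈ {q : Fin n → ℤ | ‖q‖ ≤ L}, Metric.ball (torusOrbit A q) ρ) ≤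
      (4 * ρ) ^ m * volume.real (Metric.ball x r) := by
  classical
  have hfin : {q : Fin n → ℤ | ‖q‖ ≤ L}.Finite := by
    have h := (isCompact_closedBall (0 : Fin n → ℤ) L).finite_of_discrete
    refine h.subset fun q hq => ?_
    simpa using hq
  set Q := hfin.toFinset.filter
    (fun q => (Metric.ball x r ∩ Metric.ball (torusOrbit A q) ρ).Nonempty) with hQ
  have hQL : ∀ q ∈ Q, ‖q‖ ≤ L := fun q hq => by
    rw [hQ, Finset.mem_filter] at hq
    simpa using hq.1
  have hQx : ∀ q ∈ Q, dist (torusOrbit A q) x < r + ρ := fun q hq => by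
    rw [hQ, Finset.mem_filter] at hq
    obtain ⟨z, hz1, hz2⟩ := hq.2
    rw [Metric.mem_ball] at hz1 hz2
    have := dist_triangle_left (torusOrbit A q) x z
    linarith
  have hball : ∀ (z : Fin m → AddCircle (1 : ℝ)) (s : ℝ), 0 < s →
      volume.real (Metric.ball z s) = min 1 (2 * s) ^ m := fun z s hs => by
    rw [measureReal_def, volume_torus_ball z hs, ENNReal.toReal_pow,
      ENNReal.toReal_ofReal (by positivity)]
  have hupper : volume.real (Metric.ball x r ∩
      ⋃ q ∈ {q : Fin n → ℤ | ‖q‖ ≤ L}, Metric.ball (torusOrbit A q) ρ) ≤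
      Q.card * (2 * ρ) ^ m := by
    calc _ ≤ volume.real (⋃ q ∈ Q, Metric.ball (torusOrbit A q) ρ) := by
          refine measureReal_mono ?_ (measure_ne_top _ _)
          rintro z ⟨hz1, hz2⟩
          simp only [Set.mem_iUnion] at hz2 ⊢
          obtain ⟨q, hq, hz⟩ := hz2
          exact ⟨q, by rw [hQ, Finset.mem_filter]; exact ⟨by simpa using hq, z, hz1, hz⟩, hz⟩
      _ ≤ ∑ q ∈ Q, volume.real (Metric.ball (torusOrbit A q) ρ) :=
          measureReal_biUnion_finset_le _ _
      _ ≤ ∑ q ∈ Q, (2 * ρ) ^ m := by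
          refine Finset.sum_le_sum fun q _ => ?_
          rw [hball _ _ hρ]
          gcongr
          exact min_le_right _ _
      _ = _ := by simp
  have hlower : Q.card * K * C ^ m ≤ 2 ^ m * volume.real (Metric.ball x r) := by
    have hdisj : Set.PairwiseDisjoint (↑(Q ×ˢ (Finset.univ : Finset (Fin K))))
        (fun p : (Fin n → ℤ) × Fin K => Metric.ball (torusOrbit A (p.1 + v p.2)) (C / 2)) := by
      rintro ⟨q, k⟩ hq ⟨q', k'⟩ hq' hne
      simp only [Finset.coe_product, Set.mem_prod, Finset.mem_coe] at hq hq'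
      have h1 := hQL q hq.1
      have h2 := hQL q' hq'.1
      have hd : (q + v k) - (q' + v k') ≠ 0 := by
        intro h0
        by_cases hk : k = k'
        · subst hk
          apply hne
          rw [add_sub_add_right_eq_sub, sub_eq_zero] at h0
          rw [h0]
        · have h3 := hv k k' hk
          have h4 : v k - v k' = q' - q := by
            rw [← sub_eq_zero, ← h0]
            abel
          rw [h4] at h3
          linarith [norm_sub_le q' q]
      have hdX : ‖(q + v k) - (q' + v k')‖ < X := by
        have := norm_sub_le (q + v k) (q' + v k')
        have := norm_add_le q (v k)
        have := norm_add_le q' (v k')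
        have := hvX k
        have := hvX k'
        linarith
      refine Metric.ball_disjoint_ball ?_
      rw [add_halves]
      refine (hsep _ hd hdX).trans (le_trans (le_of_eq ?_) (intDist_sub_le_dist _ _))
      rw [← Matrix.mulVec_sub]
      congr 2
      ext j
      simp
    calc (Q.card * K * C ^ m : ℝ)
        = ∑ p ∈ Q ×ˢ (Finset.univ : Finset (Fin K)),
            volume.real (Metric.ball (torusOrbit A (p.1 + v p.2)) (C / 2)) := by
          simp_rw [hball _ _ (half_pos hC), mul_div_cancel₀ C (two_ne_zero' ℝ), min_eq_right hC1]
          simp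
      _ = volume.real (⋃ p ∈ Q ×ˢ (Finset.univ : Finset (Fin K)),
            Metric.ball (torusOrbit A (p.1 + v p.2)) (C / 2)) :=
          (measureReal_biUnion_finset hdisj fun _ _ => measurableSet_ball).symm
      _ ≤ volume.real (Metric.ball x (2 * r)) := by
          refine measureReal_mono (Set.iUnion₂_subset ?_) (measure_ne_top _ _)
          rintro ⟨q, k⟩ hq
          rw [Finset.mem_product] at hq
          refine Metric.ball_subset_ball' ?_
          have h1 := hQx q hq.1
          have h2 := hvη k
          have h3 := dist_triangle (torusOrbit A (q + v k)) (torusOrbit A q) x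
          rw [torusOrbit_add, dist_self_add_left] at h3
          rw [torusOrbit_add]
          linarith
      _ ≤ 2 ^ m * volume.real (Metric.ball x r) := by
          have h := ENNReal.toReal_mono (by finiteness) (volume_torus_ball_two_mul_le x hr)
          simpa [measureReal_def] using h
  calc _ ≤ K * C ^ m * (Q.card * (2 * ρ) ^ m) := by gcongr
    _ = (Q.card * K * C ^ m) * (2 * ρ) ^ m := by ring
    _ ≤ (2 ^ m * volume.real (Metric.ball x r)) * (2 * ρ) ^ m := by gcongr
    _ = _ := by
      rw [show 4 * ρ = 2 * (2 * ρ) by ring, mul_pow 2 (2 * ρ)]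
      ring

lemma exists_separated_returns {m n : ℕ} (hn : 0 < n) (A : Matrix (Fin m) (Fin n) ℝ) {η : ℝ}
    (hη : 0 < η) (K : ℕ) : ∃ R : ℝ, ∀ L ≥ R, ∃ v : Fin K → Fin n → ℤ, (∀ k, ‖v k‖ ≤ 5 * K * L) ∧
      (∀ k k', k ≠ k' → 2 * L < ‖v k - v k'‖) ∧ ∀ k, ‖torusOrbit A (v k)‖ < η := by
  obtain ⟨T, hT, hret⟩ := exists_syndetic_return A hη
  refine ⟨2 * T + 1, fun L hL => ?_⟩
  have : Nonempty (Fin n) := ⟨⟨0, hn⟩⟩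
  have hconst : ∀ z : ℤ, ‖(fun _ : Fin n => z)‖ = |(z : ℝ)| := fun z => by
    rw [pi_norm_const, Int.norm_eq_abs]
  choose v hv hvη using fun k : Fin K => hret (fun _ => (k : ℤ) * ⌈3 * L⌉)
  have h1 := Int.le_ceil (3 * L)
  have h2 := Int.ceil_lt_add_one (3 * L)
  refine ⟨v, fun k => ?_, fun k k' hk => ?_, hvη⟩
  · have h0 : (0 : ℝ) ≤ (((k : ℤ) * ⌈3 * L⌉ : ℤ) : ℝ) := by
      push_cast
      exact mul_nonneg (by positivity) (by linarith)
    have h3 := norm_add_le (v k - fun _ => (k : ℤ) * ⌈3 * L⌉) (fun _ => (k : ℤ) * ⌈3 * L⌉)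
    rw [sub_add_cancel, hconst, abs_of_nonneg h0] at h3
    push_cast at h3
    have h4 : ((k : ℕ) : ℝ) + 1 ≤ K := by exact_mod_cast k.2
    have h5 : (0 : ℝ) ≤ (k : ℕ) := by positivity
    have h6 := hv k
    nlinarith
  · have h3 : 3 * L ≤ ‖(fun _ : Fin n => (k : ℤ) * ⌈3 * L⌉) - fun _ => (k' : ℤ) * ⌈3 * L⌉‖ := by
      have h4 : (1 : ℝ) ≤ |((k : ℕ) : ℝ) - (k' : ℕ)| := by
        have : ((k : ℕ) : ℤ) - (k' : ℕ) ≠ 0 := by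
          rw [sub_ne_zero]
          exact fun h => hk (Fin.ext (by exact_mod_cast h))
        exact_mod_cast Int.one_le_abs this
      have h5 : (fun _ : Fin n => (k : ℤ) * ⌈3 * L⌉) - (fun _ => (k' : ℤ) * ⌈3 * L⌉) =
          fun _ => ((k : ℤ) - k') * ⌈3 * L⌉ := by
        ext
        simp only [Pi.sub_apply]
        ring
      rw [h5, hconst]
      push_cast
      rw [abs_mul, abs_of_nonneg (show (0 : ℝ) ≤ ⌈3 * L⌉ by linarith)]
      nlinarith
    have h4 := norm_add₃_le (a := (fun _ : Fin n => (k : ℤ) * ⌈3 * L⌉) - v k) (b := v k - v k')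
      (c := v k' - fun _ => (k' : ℤ) * ⌈3 * L⌉)
    rw [sub_add_sub_cancel, sub_add_sub_cancel, norm_sub_rev _ (v k)] at h4
    linarith [hv k, hv k']

lemma rhoFun_uSeq {m : ℕ} (n : ℕ) {ε : ℝ} (hε : 0 < ε) (ℓ : ℕ → ℕ) (i : ℕ) :
    rhoFun m n ε (uSeq m ε ℓ i) =
      1 / 2 * (ε ^ (-(m : ℤ)) + 1) * (ε * (2 : ℝ) ^ (-(n : ℝ) * ℓ i / m)) := by
  have hM : 0 < 1 / 2 * (ε ^ (-(m : ℤ)) + 1) := by positivity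
  rw [rhoFun, uSeq]
  set M := 1 / 2 * (ε ^ (-(m : ℤ)) + 1)
  rw [Real.mul_rpow hM.le (by positivity), ← Real.rpow_natCast_mul (by norm_num),
    Real.rpow_add hM, Real.rpow_one, neg_div, Real.rpow_neg hM.le,
    show (ℓ i : ℝ) * -(n / m : ℝ) = -n * ℓ i / m by ring]
  field_simp

lemma returnScale_pow_mul {m : ℕ} (hm : 0 < m) (n : ℕ) (ε : ℝ) (l : ℕ) :
    (ε * (2 : ℝ) ^ (-(n : ℝ) * l / m)) ^ m * (2 ^ l) ^ n = ε ^ m := by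
  have hm' : (m : ℝ) ≠ 0 := by positivity
  rw [mul_pow, ← Real.rpow_mul_natCast (by norm_num), div_mul_cancel₀ _ hm', mul_assoc, ← pow_mul,
    ← Real.rpow_natCast 2 (l * n), ← Real.rpow_add (by norm_num)]
  push_cast
  rw [show -(n : ℝ) * l + l * n = 0 by ring, Real.rpow_zero, mul_one]

lemma tendsto_returnScale {m n : ℕ} (hm : 0 < m) (hn : 0 < n) (ε : ℝ) {ℓ : ℕ → ℕ}
    (hℓ : StrictMono ℓ) :
    Tendsto (fun i => ε * (2 : ℝ) ^ (-(n : ℝ) * ℓ i / m)) atTop (nhds 0) := by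
  have h : Tendsto (fun i => (n / m : ℝ) * ℓ i) atTop atTop :=
    (tendsto_natCast_atTop_atTop.comp hℓ.tendsto_atTop).const_mul_atTop (by positivity)
  have h2 := ((tendsto_rpow_atBot_of_base_gt_one 2 (by norm_num)).comp
    (tendsto_neg_atTop_atBot.comp h)).const_mul ε
  rw [mul_zero] at h2
  refine h2.congr fun i => ?_
  simp only [Function.comp_apply]
  congr 2
  ring

/-- Local ubiquity: for a non-singular `A` with infinite `ε`-return sequence
`ℓ_1 < ℓ_2 < ⋯`, there is `c₁ ∈ (0,1)` such that, with `l_i = c₁ u_i`, every ball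
`B ⊂ 𝕋^m` satisfies `|B ∩ ⋃_{l_i < ‖q‖ ≤ u_i} B(Aq, ρ(u_i))| ≥ |B|/2` eventually. -/
theorem local_ubiquity (m n : ℕ) (hm : 0 < m) (hn : 0 < n)
    (A : Matrix (Fin m) (Fin n) ℝ) (ε : ℝ) (hε : 0 < ε)
    (ℓ : ℕ → ℕ) (hmono : StrictMono ℓ) (hret : ∀ i, InReturnSeq m n A ε (ℓ i)) :
    ∃ c₁ : ℝ, 0 < c₁ ∧ c₁ < 1 ∧
      ∀ (x : Fin m → AddCircle (1 : ℝ)) (r : ℝ), 0 < r →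
        ∃ i₀ : ℕ, ∀ i ≥ i₀,
          (1 / 2 : ENNReal) * volume (Metric.ball x r) ≤
          volume (Metric.ball x r ∩
            ⋃ q ∈ {q : Fin n → ℤ |
                    c₁ * uSeq m ε ℓ i < ‖(fun j => (q j : ℝ))‖ ∧
                    ‖(fun j => (q j : ℝ))‖ ≤ uSeq m ε ℓ i},
              Metric.ball (torusProj (A.mulVec (fun j => (q j : ℝ))))
                (rhoFun m n ε (uSeq m ε ℓ i))) := by
  set M : ℝ := 1 / 2 * (ε ^ (-(m : ℤ)) + 1) with hM
  have hM2 : 1 / 2 < M := by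
    have : 0 < ε ^ (-(m : ℤ)) := by positivity
    linarith
  have hM0 : 0 < M := by linarith
  obtain ⟨K, hK⟩ := exists_nat_ge (max 1 (2 * (4 * M) ^ m))
  have hK1 : (1 : ℝ) ≤ K := (le_max_left _ _).trans hK
  have hKM : 2 * (4 * M) ^ m ≤ K := (le_max_right _ _).trans hK
  refine ⟨1 / (16 * K * M), by positivity, ?_, fun x r hr => ?_⟩
  · rw [div_lt_one (by positivity)]
    nlinarith
  obtain ⟨R, hR⟩ := exists_separated_returns hn A (η := r / 4) (by positivity) K
  have hC := tendsto_returnScale hm hn ε hmono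
  have hX : Tendsto (fun i => (2 : ℝ) ^ ℓ i) atTop atTop :=
    (tendsto_pow_atTop_atTop_of_one_lt (by norm_num)).comp hmono.tendsto_atTop
  have hCr := (hC.const_mul (M + 1 / 2)).eventually_lt_const
    (show (M + 1 / 2) * 0 < 3 / 4 * r by rw [mul_zero]; positivity)
  obtain ⟨i₀, hi₀⟩ := eventually_atTop.1 ((hC.eventually_lt_const one_pos).and
    (hCr.and (hX.eventually_ge_atTop (16 * K * R))))
  refine ⟨i₀, fun i hi => ?_⟩
  obtain ⟨hC1, hCr, hXR⟩ := hi₀ i hi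
  have hA := (hret i).2
  have hu : uSeq m ε ℓ i = M * 2 ^ ℓ i := rfl
  have hCX := returnScale_pow_mul hm n ε (ℓ i)
  rw [rhoFun_uSeq n hε, hu, ← hM]
  clear hC hX hi₀ hret hu
  set C : ℝ := ε * (2 : ℝ) ^ (-(n : ℝ) * ℓ i / m)
  set X : ℝ := 2 ^ ℓ i
  have hC0 : 0 < C := by positivity
  have hX0 : 0 < X := by positivity
  rw [show 1 / (16 * K * M) * (M * X) = X / (16 * K) by field_simp]
  simp only [norm_cast_int_pi] at hA ⊢
  have hsep : ∀ q : Fin n → ℤ, q ≠ 0 → ‖q‖ < X →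
      C ≤ intDist (A.mulVec (fun j => (q j : ℝ))) := fun q hq hqX => by
    by_contra! h
    exact hA ⟨q, h, norm_pos_iff.2 hq, hqX⟩
  have hcov : ∀ z, ∃ q : Fin n → ℤ, ‖q‖ ≤ M * X ∧ dist z (torusOrbit A q) ≤ M * C := by
    intro z
    obtain ⟨α, rfl⟩ := torusProj_surjective z
    have hk : 1 < ((⌊ε ^ (-(m : ℤ))⌋₊ + 1 : ℕ) : ℝ) * (C ^ m * X ^ n) := by
      rw [hCX, ← div_lt_iff₀ (by positivity)]
      have := Nat.lt_floor_add_one (ε ^ (-(m : ℤ)))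
      push_cast
      simpa using this
    have hkM : ((⌊ε ^ (-(m : ℤ))⌋₊ + 1 : ℕ) : ℝ) / 2 ≤ M := by
      have := Nat.floor_le (show 0 ≤ ε ^ (-(m : ℤ)) by positivity)
      push_cast
      linarith
    obtain ⟨q, hq, P, hP⟩ := exists_inhomogeneous_solution A hC0 hC1.le hX0
      (by simpa only [norm_cast_int_pi] using hsep) _ hk α
    rw [norm_cast_int_pi] at hq
    exact ⟨q, hq.trans (by gcongr), (dist_torusProj_le _ _ P).trans (hP.trans (by gcongr))⟩
  have hall := volume_le_volume_inter_biUnion_ball A (by positivity) hcov (Metric.ball x r)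
  obtain ⟨v, hvX, hv, hvη⟩ := hR (X / (16 * K)) (by rwa [ge_iff_le, le_div_iff₀' (by positivity)])
  have hshort := measureReal_ball_inter_biUnion_ball_le A hC0 hC1.le (ρ := M * C) (by positivity)
    hr hsep v (fun k => ?_) hv hvη (by linarith) x
  swap
  · have h1 : 5 * K * (X / (16 * K)) = 5 / 16 * X := by field_simp
    have h2 : X / (16 * K) ≤ X / 16 := by gcongr; linarith
    linarith [hvX k]
  set S := Metric.ball x r ∩
    ⋃ q ∈ {q : Fin n → ℤ | ‖q‖ ≤ X / (16 * K)}, Metric.ball (torusOrbit A q) (M * C)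
  have hS : volume.real S ≤ 1 / 2 * volume.real (Metric.ball x r) := by
    have h1 : 2 * (4 * M) ^ m * C ^ m * volume.real S ≤ K * C ^ m * volume.real S := by gcongr
    rw [← mul_assoc, mul_pow (4 * M)] at hshort
    have h2 : 0 < (4 * M) ^ m * C ^ m := by positivity
    nlinarith
  have hS' : volume S ≤ 1 / 2 * volume (Metric.ball x r) := by
    rw [← ENNReal.toReal_le_toReal (by finiteness) (by finiteness), ENNReal.toReal_mul]
    simpa [measureReal_def] using hS
  have hhalf : (1 / 2 : ENNReal) * volume (Metric.ball x r) +
      1 / 2 * volume (Metric.ball x r) = volume (Metric.ball x r) := by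
    rw [← add_mul, ENNReal.add_halves, one_mul]
  refine ENNReal.le_of_add_le_add_right (a := 1 / 2 * volume (Metric.ball x r)) (by finiteness) ?_
  rw [hhalf]
  refine (hall.trans ?_).trans (add_le_add_right hS' _)
  refine (measure_mono ?_).trans (measure_union_le _ _)
  rintro z ⟨hzx, hz⟩
  simp only [Set.mem_iUnion] at hz
  obtain ⟨q, hq, hz⟩ := hz
  rcases lt_or_ge (X / (16 * K)) ‖q‖ with h | h
  · exact Or.inl ⟨hzx, Set.mem_biUnion (show q ∈ {q : Fin n → ℤ | _} from ⟨h, hq⟩) hz⟩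
  · exact Or.inr ⟨hzx, Set.mem_biUnion (show q ∈ {q : Fin n → ℤ | _} from h) hz⟩
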